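/- Assume 𝔄 acts trivially on 𝒜 from the left and that 𝒜/J has a left identity. If the Banach algebra 𝒜 is biflat, then 𝒜 is module biflat as an 𝔄-module. -/

import Mathlib

noncomputable section

open scoped Topology

universe u u₁ u₂ u₃ v w

/-- The smallest closed two-sided ideal (realized as a `ℂ`-submodule which is topologically
closed and stable under multiplication by arbitrary elements) containing a given set. -/
def closedIdealGen {R : Type u} [NonUnitalNormedRing R] [NormedSpace ℂ R] (s : Set R) :
    Submodule ℂ R :=
  sInf {p : Submodule ℂ R |
    s ⊆ (p : Set R) ∧ IsClosed (p : Set R) ∧ ∀ x ∈ p, ∀ y : R, x * y ∈ p ∧ y * x ∈ p}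

/-- Data exhibiting the Banach space `TB` as the projective tensor product `B ⊗̂ B` of a
Banach algebra `B` with itself. -/
structure TensorSquareSetting (B : Type u) (TB : Type v)
    [NonUnitalNormedRing B] [NormedSpace ℂ B] [CompleteSpace B]
    [NonUnitalNormedRing TB] [NormedSpace ℂ TB] [CompleteSpace TB] where
  tp : B → B → TB
  tp_add_left : ∀ a b c, tp (a + b) c = tp a c + tp b c
  tp_add_right : ∀ a b c, tp a (b + c) = tp a b + tp a c
  tp_smul_left : ∀ (z : ℂ) a b, tp (z • a) b = z • tp a b
  tp_smul_right : ∀ (z : ℂ) a b, tp a (z • b) = z • tp a b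
  tp_norm : ∀ a b, ‖tp a b‖ ≤ ‖a‖ * ‖b‖
  tp_mul : ∀ a b c d, tp a b * tp c d = tp (a * c) (b * d)
  tp_dense :
    Dense ((Submodule.span ℂ (Set.range fun p : B × B => tp p.1 p.2) : Submodule ℂ TB) : Set TB)
  tp_universal : ∀ {X : Type w} [NormedAddCommGroup X] [NormedSpace ℂ X] [CompleteSpace X]
      (φ : B →L[ℂ] B →L[ℂ] X),
      ∃ ψ : TB →L[ℂ] X, ‖ψ‖ ≤ ‖φ‖ ∧ ∀ a b, ψ (tp a b) = φ a b
  lmul : B → TB →L[ℂ] TB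
  rmul : B → TB →L[ℂ] TB
  lmul_tp : ∀ a b c, lmul a (tp b c) = tp (a * b) c
  rmul_tp : ∀ a b c, rmul a (tp b c) = tp b (c * a)
  ω : TB →L[ℂ] B
  ω_tp : ∀ a b, ω (tp a b) = a * b

/-- A Banach algebra `B` is biprojective if the multiplication map
`ω : B ⊗̂ B → B` has a bounded right inverse which is a `B`-bimodule homomorphism. -/
def TensorSquareSetting.Biprojective {B : Type u} {TB : Type v}
    [NonUnitalNormedRing B] [NormedSpace ℂ B] [CompleteSpace B]
    [NonUnitalNormedRing TB] [NormedSpace ℂ TB] [CompleteSpace TB]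
    (ts : TensorSquareSetting B TB) : Prop :=
  ∃ ρ : B →L[ℂ] TB,
    (∀ a b, ρ (a * b) = ts.lmul a (ρ b)) ∧
    (∀ a b, ρ (b * a) = ts.rmul a (ρ b)) ∧
    (∀ a, ts.ω (ρ a) = a)

/-- A Banach algebra `B` is biflat if the adjoint `ω* : B* → (B ⊗̂ B)*` of the multiplication
map has a bounded left inverse which is a `B`-bimodule homomorphism (for the dual actions
`a · f = f(· a)` and `f · a = f(a ·)`). -/
def TensorSquareSetting.Biflat {B : Type u} {TB : Type v}
    [NonUnitalNormedRing B] [NormedSpace ℂ B] [CompleteSpace B]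
    [NonUnitalNormedRing TB] [NormedSpace ℂ TB] [CompleteSpace TB]
    [IsScalarTower ℂ B B] [SMulCommClass ℂ B B]
    (ts : TensorSquareSetting B TB) : Prop :=
  ∃ θ : (TB →L[ℂ] ℂ) →L[ℂ] (B →L[ℂ] ℂ),
    (∀ (a : B) (f : TB →L[ℂ] ℂ),
      θ (f.comp (ts.rmul a)) = (θ f).comp ((ContinuousLinearMap.mul ℂ B).flip a)) ∧
    (∀ (a : B) (f : TB →L[ℂ] ℂ),
      θ (f.comp (ts.lmul a)) = (θ f).comp (ContinuousLinearMap.mul ℂ B a)) ∧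
    (∀ g : B →L[ℂ] ℂ, θ (g.comp ts.ω) = g)

/-- Compatible bounded bimodule actions of a Banach algebra `𝔄` on a Banach algebra `𝒜`:
`lsmul α a = α · a` and `rsmul α a = a · α`, with `α · (a b) = (α · a) b` and
`(a b) · α = a (b · α)`. -/
structure ActionSetting (𝔄 : Type u₁) (𝒜 : Type u)
    [NonUnitalNormedRing 𝔄] [NormedSpace ℂ 𝔄] [CompleteSpace 𝔄]
    [NonUnitalNormedRing 𝒜] [NormedSpace ℂ 𝒜] [CompleteSpace 𝒜] where
  lsmul : 𝔄 → 𝒜 →L[ℂ] 𝒜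
  rsmul : 𝔄 → 𝒜 →L[ℂ] 𝒜
  lsmul_add : ∀ α β, lsmul (α + β) = lsmul α + lsmul β
  lsmul_smulc : ∀ (z : ℂ) α, lsmul (z • α) = z • lsmul α
  rsmul_add : ∀ α β, rsmul (α + β) = rsmul α + rsmul β
  rsmul_smulc : ∀ (z : ℂ) α, rsmul (z • α) = z • rsmul α
  lsmul_bound : ∃ C : ℝ, ∀ α, ‖lsmul α‖ ≤ C * ‖α‖
  rsmul_bound : ∃ C : ℝ, ∀ α, ‖rsmul α‖ ≤ C * ‖α‖
  lsmul_mulA : ∀ α β a, lsmul (α * β) a = lsmul α (lsmul β a)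
  rsmul_mulA : ∀ α β a, rsmul (α * β) a = rsmul β (rsmul α a)
  lsmul_rsmul : ∀ α β a, rsmul β (lsmul α a) = lsmul α (rsmul β a)
  lsmul_compat : ∀ α a b, lsmul α (a * b) = lsmul α a * b
  rsmul_compat : ∀ α a b, rsmul α (a * b) = a * rsmul α b

/-- The full setting of the paper: `𝒜` is a Banach algebra with compatible `𝔄`-actions,
`T = 𝒜 ⊗̂ 𝒜` is its projective tensor square carrying the induced `𝔄`-actions
(`tlsmul α (a ⊗ b) = (α·a) ⊗ b`, `trsmul α (a ⊗ b) = a ⊗ (b·α)`), `I ⊆ T` is the closed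
ideal generated by the elements `α·a ⊗ b - a ⊗ b·α`, `J ⊆ 𝒜` is the closed ideal generated
by `ω(I)`, and the induced bounded operators on the quotient Banach spaces
`T ⧸ I = 𝒜 ⊗̂_𝔄 𝒜` and `𝒜 ⧸ J` are recorded: `qω` is the induced multiplication map `ω̃`,
`qlsmul/qrsmul` (resp. `qtlsmul/qtrsmul`) are the induced `𝔄`-actions on `𝒜 ⧸ J`
(resp. `T ⧸ I`), and `qmulL/qmulR` (resp. `qlmul/qrmul`) are the induced `𝒜`- (hence
`𝒜/J`-) bimodule actions on `𝒜 ⧸ J` (resp. `T ⧸ I`). -/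
structure ModuleSetting (𝔄 : Type u₁) (𝒜 : Type u) (T : Type v)
    [NonUnitalNormedRing 𝔄] [NormedSpace ℂ 𝔄] [CompleteSpace 𝔄]
    [NonUnitalNormedRing 𝒜] [NormedSpace ℂ 𝒜] [CompleteSpace 𝒜]
    [NonUnitalNormedRing T] [NormedSpace ℂ T] [CompleteSpace T] extends
    TensorSquareSetting 𝒜 T, ActionSetting 𝔄 𝒜 where
  tlsmul : 𝔄 → T →L[ℂ] T
  trsmul : 𝔄 → T →L[ℂ] T
  tlsmul_tp : ∀ α a b, tlsmul α (tp a b) = tp (lsmul α a) b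
  trsmul_tp : ∀ α a b, trsmul α (tp a b) = tp a (rsmul α b)
  I : Submodule ℂ T
  J : Submodule ℂ 𝒜
  hI : I = closedIdealGen
    {x : T | ∃ (α : 𝔄) (a b : 𝒜), x = tlsmul α (tp a b) - trsmul α (tp a b)}
  hJ : J = closedIdealGen (ω '' I)
  qω : (T ⧸ I) →L[ℂ] (𝒜 ⧸ J)
  qω_mk : ∀ t, qω (Submodule.Quotient.mk t) = Submodule.Quotient.mk (ω t)
  qlsmul : 𝔄 → (𝒜 ⧸ J) →L[ℂ] (𝒜 ⧸ J)
  qrsmul : 𝔄 → (𝒜 ⧸ J) →L[ℂ] (𝒜 ⧸ J)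
  qlsmul_mk : ∀ α a, qlsmul α (Submodule.Quotient.mk a) = Submodule.Quotient.mk (lsmul α a)
  qrsmul_mk : ∀ α a, qrsmul α (Submodule.Quotient.mk a) = Submodule.Quotient.mk (rsmul α a)
  qmulL : 𝒜 → (𝒜 ⧸ J) →L[ℂ] (𝒜 ⧸ J)
  qmulR : 𝒜 → (𝒜 ⧸ J) →L[ℂ] (𝒜 ⧸ J)
  qmulL_mk : ∀ a b, qmulL a (Submodule.Quotient.mk b) = Submodule.Quotient.mk (a * b)
  qmulR_mk : ∀ a b, qmulR a (Submodule.Quotient.mk b) = Submodule.Quotient.mk (b * a)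
  qtlsmul : 𝔄 → (T ⧸ I) →L[ℂ] (T ⧸ I)
  qtrsmul : 𝔄 → (T ⧸ I) →L[ℂ] (T ⧸ I)
  qtlsmul_mk : ∀ α t, qtlsmul α (Submodule.Quotient.mk t) = Submodule.Quotient.mk (tlsmul α t)
  qtrsmul_mk : ∀ α t, qtrsmul α (Submodule.Quotient.mk t) = Submodule.Quotient.mk (trsmul α t)
  qlmul : 𝒜 → (T ⧸ I) →L[ℂ] (T ⧸ I)
  qrmul : 𝒜 → (T ⧸ I) →L[ℂ] (T ⧸ I)
  qlmul_mk : ∀ a t, qlmul a (Submodule.Quotient.mk t) = Submodule.Quotient.mk (lmul a t)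
  qrmul_mk : ∀ a t, qrmul a (Submodule.Quotient.mk t) = Submodule.Quotient.mk (rmul a t)

namespace ModuleSetting

variable {𝔄 : Type u₁} {𝒜 : Type u} {T : Type v}
    [NonUnitalNormedRing 𝔄] [NormedSpace ℂ 𝔄] [CompleteSpace 𝔄]
    [NonUnitalNormedRing 𝒜] [NormedSpace ℂ 𝒜] [CompleteSpace 𝒜]
    [NonUnitalNormedRing T] [NormedSpace ℂ T] [CompleteSpace T]

/-- `𝒜` is module biprojective (as an `𝔄`-module) if the induced multiplication map
`ω̃ : 𝒜 ⊗̂_𝔄 𝒜 → 𝒜 ⧸ J` has a bounded right inverse which is an `𝒜/J`-`𝔄`-module morphism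
(a bounded additive map commuting with the `𝔄`-actions and the `𝒜/J`-bimodule actions). -/
def ModuleBiprojective (S : ModuleSetting 𝔄 𝒜 T) : Prop :=
  ∃ ρ : (𝒜 ⧸ S.J) → (T ⧸ S.I),
    (∀ x y, ρ (x + y) = ρ x + ρ y) ∧
    (∃ C : ℝ, ∀ x, ‖ρ x‖ ≤ C * ‖x‖) ∧
    (∀ α x, ρ (S.qlsmul α x) = S.qtlsmul α (ρ x)) ∧
    (∀ α x, ρ (S.qrsmul α x) = S.qtrsmul α (ρ x)) ∧
    (∀ a x, ρ (S.qmulL a x) = S.qlmul a (ρ x)) ∧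
    (∀ a x, ρ (S.qmulR a x) = S.qrmul a (ρ x)) ∧
    (∀ x, S.qω (ρ x) = x)

/-- `𝒜` is module biflat (as an `𝔄`-module) if the adjoint
`ω̃* : (𝒜 ⧸ J)* → (𝒜 ⊗̂_𝔄 𝒜)*` has a bounded left inverse which is an `𝒜/J`-`𝔄`-module
morphism (for the dual actions). -/
def ModuleBiflat (S : ModuleSetting 𝔄 𝒜 T) : Prop :=
  ∃ θ : ((T ⧸ S.I) →L[ℂ] ℂ) → ((𝒜 ⧸ S.J) →L[ℂ] ℂ),
    (∀ f g, θ (f + g) = θ f + θ g) ∧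
    (∃ C : ℝ, ∀ f, ‖θ f‖ ≤ C * ‖f‖) ∧
    (∀ α f, θ (f.comp (S.qtrsmul α)) = (θ f).comp (S.qrsmul α)) ∧
    (∀ α f, θ (f.comp (S.qtlsmul α)) = (θ f).comp (S.qlsmul α)) ∧
    (∀ a f, θ (f.comp (S.qrmul a)) = (θ f).comp (S.qmulR a)) ∧
    (∀ a f, θ (f.comp (S.qlmul a)) = (θ f).comp (S.qmulL a)) ∧
    (∀ g : (𝒜 ⧸ S.J) →L[ℂ] ℂ, θ (g.comp S.qω) = g)

/-- `𝔄` acts trivially on `𝒜` from the left, via the continuous functional `f`: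
`α · a = f(α) a`. -/
def TrivialLeftAction (S : ModuleSetting 𝔄 𝒜 T) (f : 𝔄 →L[ℂ] ℂ) : Prop :=
  ∀ α a, S.lsmul α a = f α • a

/-- The quotient algebra `𝒜 ⧸ J` has a left identity `e + J`. -/
def HasLeftIdentity (S : ModuleSetting 𝔄 𝒜 T) : Prop :=
  ∃ e : 𝒜, ∀ x : 𝒜 ⧸ S.J, S.qmulL e x = x

/-- The quotient algebra `𝒜 ⧸ J` has an identity `e + J`. -/
def HasIdentity (S : ModuleSetting 𝔄 𝒜 T) : Prop :=
  ∃ e : 𝒜, ∀ x : 𝒜 ⧸ S.J, S.qmulL e x = x ∧ S.qmulR e x = x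

/-- `𝔄` has a bounded approximate identity for `𝒜`: a bounded net `(α_j)` in `𝔄` with
`‖α_j · a - a‖ → 0` and `‖a · α_j - a‖ → 0` for every `a ∈ 𝒜`. -/
def HasBoundedApproximateIdentityFor (S : ModuleSetting 𝔄 𝒜 T) : Prop :=
  ∃ C : ℝ, 0 < C ∧ ∀ ε : ℝ, 0 < ε → ∀ F : Finset 𝒜, ∃ α : 𝔄, ‖α‖ ≤ C ∧
    ∀ a ∈ F, ‖S.lsmul α a - a‖ < ε ∧ ‖S.rsmul α a - a‖ < ε

/-- The quotient algebra `𝒜 ⧸ J` has a bounded approximate identity. -/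
def QuotientHasBoundedApproximateIdentity (S : ModuleSetting 𝔄 𝒜 T) : Prop :=
  ∃ C : ℝ, 0 < C ∧ ∀ ε : ℝ, 0 < ε → ∀ F : Finset (𝒜 ⧸ S.J), ∃ e : 𝒜,
    ‖(Submodule.Quotient.mk e : 𝒜 ⧸ S.J)‖ ≤ C ∧
    ∀ x ∈ F, ‖S.qmulL e x - x‖ < ε ∧ ‖S.qmulR e x - x‖ < ε

/-- `𝒜 ⧸ J` is a commutative `𝔄`-module. -/
def QuotientCommutative (S : ModuleSetting 𝔄 𝒜 T) : Prop :=
  ∀ (α : 𝔄) (x : 𝒜 ⧸ S.J), S.qlsmul α x = S.qrsmul α x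

end ModuleSetting

section ClosedIdeal

variable {R : Type*} [NonUnitalNormedRing R] [NormedSpace ℂ R]

theorem subset_closedIdealGen (s : Set R) : s ⊆ closedIdealGen s := fun _ hx =>
  Submodule.mem_sInf.2 fun _ hp => hp.1 hx

theorem isClosed_closedIdealGen (s : Set R) : IsClosed (closedIdealGen s : Set R) := by
  rw [closedIdealGen, Submodule.coe_sInf]
  exact isClosed_biInter fun p hp => hp.2.1

theorem mul_mem_closedIdealGen {s : Set R} {x : R} (hx : x ∈ closedIdealGen s) (y : R) :
    x * y ∈ closedIdealGen s ∧ y * x ∈ closedIdealGen s :=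
  ⟨Submodule.mem_sInf.2 fun p hp => (hp.2.2 x (Submodule.mem_sInf.1 hx p hp) y).1,
    Submodule.mem_sInf.2 fun p hp => (hp.2.2 x (Submodule.mem_sInf.1 hx p hp) y).2⟩

theorem closedIdealGen_le {s : Set R} {p : Submodule ℂ R} (hs : s ⊆ p)
    (hp : IsClosed (p : Set R)) (hmul : ∀ x ∈ p, ∀ y : R, x * y ∈ p ∧ y * x ∈ p) :
    closedIdealGen s ≤ p :=
  sInf_le ⟨hs, hp, hmul⟩

end ClosedIdeal

/-- A bounded operator mapping a set into a closed subspace maps its closed span there. -/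
theorem ContinuousLinearMap.mem_of_mem_topologicalClosure_span {E F : Type*}
    [NormedAddCommGroup E] [NormedSpace ℂ E] [NormedAddCommGroup F] [NormedSpace ℂ F]
    (φ : E →L[ℂ] F) {s : Set E} {q : Submodule ℂ F} (hq : IsClosed (q : Set F))
    (h : ∀ x ∈ s, φ x ∈ q) {x : E} (hx : x ∈ (Submodule.span ℂ s).topologicalClosure) :
    φ x ∈ q :=
  Submodule.topologicalClosure_minimal (t := q.comap φ.toLinearMap) _ (Submodule.span_le.2 h)
    (hq.preimage φ.continuous) hx

section Preliminaries

variable {𝔄 : Type u₁} {𝒜 : Type u} {T : Type v}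
  [NonUnitalNormedRing 𝔄] [NormedSpace ℂ 𝔄] [CompleteSpace 𝔄]
  [NonUnitalNormedRing 𝒜] [NormedSpace ℂ 𝒜] [CompleteSpace 𝒜]
  [NonUnitalNormedRing T] [NormedSpace ℂ T] [CompleteSpace T]

namespace TensorSquareSetting

/-- The elementary tensor map `b ↦ a ⊗ b` as a bounded operator. -/
def tpRight (ts : TensorSquareSetting 𝒜 T) (a : 𝒜) : 𝒜 →L[ℂ] T :=
  LinearMap.mkContinuous
    { toFun := ts.tp a
      map_add' := ts.tp_add_right a
      map_smul' := fun z b => ts.tp_smul_right z a b } ‖a‖ (ts.tp_norm a)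

/-- The elementary tensor map `a ↦ a ⊗ b` as a bounded operator. -/
def tpLeft (ts : TensorSquareSetting 𝒜 T) (b : 𝒜) : 𝒜 →L[ℂ] T :=
  LinearMap.mkContinuous
    { toFun := fun a => ts.tp a b
      map_add' := fun a c => ts.tp_add_left a c b
      map_smul' := fun z a => ts.tp_smul_left z a b } ‖b‖
    (fun a => (ts.tp_norm a b).trans_eq (mul_comm _ _))

/-- A closed subspace of the tensor square containing the elementary tensors is everything. -/
theorem eq_top_of_tp_mem (ts : TensorSquareSetting 𝒜 T) {p : Submodule ℂ T}
    (hp : IsClosed (p : Set T)) (h : ∀ a b, ts.tp a b ∈ p) : p = ⊤ := by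
  refine eq_top_iff.2 fun t _ => ?_
  have hspan : Submodule.span ℂ (Set.range fun q : 𝒜 × 𝒜 => ts.tp q.1 q.2) ≤ p :=
    Submodule.span_le.2 (by rintro _ ⟨q, rfl⟩; exact h q.1 q.2)
  exact closure_minimal hspan hp (ts.tp_dense t)

/-- Bounded operators agreeing on elementary tensors are equal. -/
theorem ext_tp (ts : TensorSquareSetting 𝒜 T) {X : Type*} [NormedAddCommGroup X] [NormedSpace ℂ X]
    {φ ψ : T →L[ℂ] X} (h : ∀ a b, φ (ts.tp a b) = ψ (ts.tp a b)) : φ = ψ := by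
  have := ts.eq_top_of_tp_mem (p := (φ - ψ).ker) (φ - ψ).isClosed_ker
    (fun a b => by simp [h a b])
  ext t
  have ht : t ∈ (φ - ψ).ker := this ▸ Submodule.mem_top
  simpa [sub_eq_zero] using ht

end TensorSquareSetting

namespace ModuleSetting

theorem isClosed_I (S : ModuleSetting 𝔄 𝒜 T) : IsClosed (S.I : Set T) := by
  rw [S.hI]; exact isClosed_closedIdealGen _

theorem isClosed_J (S : ModuleSetting 𝔄 𝒜 T) : IsClosed (S.J : Set 𝒜) := by
  rw [S.hJ]; exact isClosed_closedIdealGen _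

theorem mul_mem_I (S : ModuleSetting 𝔄 𝒜 T) {x : T} (hx : x ∈ S.I) (y : T) :
    x * y ∈ S.I ∧ y * x ∈ S.I := by
  rw [S.hI] at hx ⊢; exact mul_mem_closedIdealGen hx y

theorem ω_mem_J (S : ModuleSetting 𝔄 𝒜 T) {x : T} (hx : x ∈ S.I) : S.ω x ∈ S.J := by
  rw [S.hJ]; exact subset_closedIdealGen _ ⟨x, hx, rfl⟩

/-- When the left action is trivial, the defining generators of `I` are
`a ⊗ (f(α) b - b·α)`. -/
theorem tp_sub_mem_I (S : ModuleSetting 𝔄 𝒜 T) {f : 𝔄 →L[ℂ] ℂ} (hf : S.TrivialLeftAction f)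
    (α : 𝔄) (a b : 𝒜) : S.tp a (f α • b - S.rsmul α b) ∈ S.I := by
  rw [S.hI]
  refine subset_closedIdealGen _ ⟨α, a, b, ?_⟩
  rw [S.tlsmul_tp, S.trsmul_tp, hf, S.tp_smul_left, ← S.tp_smul_right]
  exact map_sub (S.tpRight a) _ _

theorem smul_sub_trsmul_mem_I (S : ModuleSetting 𝔄 𝒜 T) {f : 𝔄 →L[ℂ] ℂ}
    (hf : S.TrivialLeftAction f) (α : 𝔄) (t : T) : f α • t - S.trsmul α t ∈ S.I := by
  set φ : T →L[ℂ] T := f α • ContinuousLinearMap.id ℂ T - S.trsmul α with hφ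
  have : S.I.comap φ.toLinearMap = ⊤ :=
    S.eq_top_of_tp_mem (S.isClosed_I.preimage φ.continuous) fun a b => by
      have h := S.tp_sub_mem_I hf α a b
      have h2 : S.tp a (f α • b - S.rsmul α b) = φ (S.tp a b) := by
        rw [hφ]
        simp only [_root_.sub_apply, _root_.smul_apply,
          ContinuousLinearMap.id_apply, S.trsmul_tp, ← S.tp_smul_right]
        exact map_sub (S.tpRight a) _ _
      rw [h2] at h
      exact h
  have ht : t ∈ S.I.comap φ.toLinearMap := this ▸ Submodule.mem_top
  simpa [hφ] using ht

theorem tlsmul_eq_smul (S : ModuleSetting 𝔄 𝒜 T) {f : 𝔄 →L[ℂ] ℂ}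
    (hf : S.TrivialLeftAction f) (α : 𝔄) (t : T) : S.tlsmul α t = f α • t := by
  have : S.tlsmul α = f α • ContinuousLinearMap.id ℂ T := S.ext_tp fun a b => by
    simp [S.tlsmul_tp, hf α a, S.tp_smul_left]
  simp [this]

/-- The subspace of all `k` with `a ⊗ k ∈ I` for every `a`. -/
def rightKernel (S : ModuleSetting 𝔄 𝒜 T) : Submodule ℂ 𝒜 :=
  ⨅ a, S.I.comap (S.tpRight a).toLinearMap

theorem mem_rightKernel (S : ModuleSetting 𝔄 𝒜 T) {k : 𝒜} :
    k ∈ S.rightKernel ↔ ∀ a, S.tp a k ∈ S.I :=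
  Submodule.mem_iInf _

end ModuleSetting

end Preliminaries

variable {𝔄 : Type u₁} {𝒜 : Type u} {T : Type v}
  [NonUnitalNormedRing 𝔄] [NormedSpace ℂ 𝔄] [CompleteSpace 𝔄]
  [NonUnitalNormedRing 𝒜] [NormedSpace ℂ 𝒜] [CompleteSpace 𝒜]
  [NonUnitalNormedRing T] [NormedSpace ℂ T] [CompleteSpace T]
  [IsScalarTower ℂ 𝒜 𝒜] [SMulCommClass ℂ 𝒜 𝒜]

namespace TensorSquareSetting

theorem smul_mul_smul_comm (ts : TensorSquareSetting 𝒜 T) (z w : ℂ) (x y : T) :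
    (z • x) * (w • y) = (z * w) • (x * y) := by
  revert z w x y
  suffices h : ∀ y : T, ∀ (z w : ℂ) (x : T), (z • x) * (w • y) = (z * w) • (x * y) from
    fun z w x y => h y z w x
  intro y
  refine closure_minimal (s := (Submodule.span ℂ (Set.range fun q : 𝒜 × 𝒜 => ts.tp q.1 q.2) :
      Submodule ℂ T)) (t := {y : T | ∀ (z w : ℂ) (x : T), (z • x) * (w • y) = (z * w) • (x * y)})
    ?_ ?_ (ts.tp_dense y)
  · intro y hy
    induction hy using Submodule.span_induction with
    | zero => intro z w x; simp
    | add u v _ _ hu hv => intro z w x; rw [smul_add, mul_add, hu, hv, mul_add, smul_add]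
    | smul c u _ hu =>
      intro z w x
      have h1 := hu 1 c x
      rw [one_smul, one_mul] at h1
      rw [smul_smul, hu, h1, smul_smul, mul_assoc]
    | mem y hy =>
      obtain ⟨⟨c, d⟩, rfl⟩ := hy
      intro z w x
      refine closure_minimal (s := (Submodule.span ℂ (Set.range fun q : 𝒜 × 𝒜 => ts.tp q.1 q.2) :
          Submodule ℂ T))
        (t := {x : T | ∀ z w : ℂ, (z • x) * (w • ts.tp c d) = (z * w) • (x * ts.tp c d)})
        ?_ ?_ (ts.tp_dense x) z w
      · intro x hx
        induction hx using Submodule.span_induction with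
        | zero => intro z w; simp
        | add u v _ _ hu hv => intro z w; rw [smul_add, add_mul, hu, hv, add_mul, smul_add]
        | smul r u _ hu =>
          intro z w
          have h1 := hu r 1
          rw [one_smul, mul_one] at h1
          rw [smul_smul, hu, h1, smul_smul]
          congr 1; ring
        | mem x hx =>
          obtain ⟨⟨a, b⟩, rfl⟩ := hx
          intro z w
          simp only [← ts.tp_smul_left, ts.tp_mul]
          rw [_root_.smul_mul_smul_comm]
      · simp only [Set.ofPred_forall]
        exact isClosed_iInter fun z => isClosed_iInter fun w =>
          isClosed_eq (by fun_prop) (by fun_prop)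
  · simp only [Set.ofPred_forall]
    exact isClosed_iInter fun z => isClosed_iInter fun w => isClosed_iInter fun x =>
      isClosed_eq (by fun_prop) (by fun_prop)

theorem isScalarTower (ts : TensorSquareSetting 𝒜 T) : IsScalarTower ℂ T T :=
  ⟨fun z x y => by simpa using ts.smul_mul_smul_comm z 1 x y⟩

theorem smulCommClass (ts : TensorSquareSetting 𝒜 T) : SMulCommClass ℂ T T :=
  ⟨fun z x y => by simpa using (ts.smul_mul_smul_comm 1 z x y).symm⟩

/-- If `𝒜` is biflat, a closed subspace of `𝒜` containing all products is everything. -/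
theorem Biflat.eq_top_of_mul_mem {ts : TensorSquareSetting 𝒜 T} (h : ts.Biflat)
    {p : Submodule ℂ 𝒜} (hp : IsClosed (p : Set 𝒜)) (hmul : ∀ a b, a * b ∈ p) : p = ⊤ := by
  obtain ⟨θ, -, -, hθ⟩ := h
  have : IsClosed (p : Set 𝒜) := hp
  refine eq_top_iff.2 fun x _ => ?_
  rw [← Submodule.Quotient.mk_eq_zero]
  refine SeparatingDual.eq_zero_of_forall_dual_eq_zero (R := ℂ) fun g => ?_
  set k : 𝒜 →L[ℂ] ℂ := g.comp p.mkQL with hk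
  have hzero : k.comp ts.ω = 0 := ts.ext_tp fun a b => by
    have : p.mkQL (a * b) = 0 := (Submodule.Quotient.mk_eq_zero p).2 (hmul a b)
    simp [hk, ts.ω_tp, this]
  have hk0 : k = 0 := by rw [← hθ k, hzero, map_zero]
  exact congrArg (fun l : 𝒜 →L[ℂ] ℂ => l x) hk0

end TensorSquareSetting

namespace ModuleSetting

/-- If `𝒜` is biflat, then `f(α) b - b·α` always lies in `J`. -/
theorem smul_sub_rsmul_mem_J (S : ModuleSetting 𝔄 𝒜 T) {f : 𝔄 →L[ℂ] ℂ}
    (hf : S.TrivialLeftAction f) (hb : S.toTensorSquareSetting.Biflat) (α : 𝔄) (b : 𝒜) :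
    f α • b - S.rsmul α b ∈ S.J := by
  set φ : 𝒜 →L[ℂ] 𝒜 := f α • ContinuousLinearMap.id ℂ 𝒜 - S.rsmul α with hφ
  have : S.J.comap φ.toLinearMap = ⊤ :=
    hb.eq_top_of_mul_mem (S.isClosed_J.preimage φ.continuous) fun a b => by
      have h := S.ω_mem_J (S.tp_sub_mem_I hf α a b)
      rw [S.ω_tp, mul_sub, mul_smul_comm, ← S.rsmul_compat] at h
      simpa [hφ] using h
  have ht : b ∈ S.J.comap φ.toLinearMap := this ▸ Submodule.mem_top
  simpa [hφ] using ht

/-- If `𝒜` is biflat, the subspace `rightKernel` is a two-sided ideal. -/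
theorem mul_mem_rightKernel (S : ModuleSetting 𝔄 𝒜 T) (hb : S.toTensorSquareSetting.Biflat)
    {k : 𝒜} (hk : k ∈ S.rightKernel) (e : 𝒜) :
    k * e ∈ S.rightKernel ∧ e * k ∈ S.rightKernel := by
  rw [mem_rightKernel] at hk
  have key : ∀ c : 𝒜, (∀ a b, S.tp (a * b) c ∈ S.I) → c ∈ S.rightKernel := by
    intro c hc
    have : S.I.comap (S.tpLeft c).toLinearMap = ⊤ :=
      hb.eq_top_of_mul_mem (S.isClosed_I.preimage (S.tpLeft c).continuous) hc
    refine S.mem_rightKernel.2 fun a => ?_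
    have ha : a ∈ S.I.comap (S.tpLeft c).toLinearMap := this ▸ Submodule.mem_top
    exact ha
  refine ⟨key _ fun a b => ?_, key _ fun a b => ?_⟩
  · rw [← S.tp_mul]; exact (S.mul_mem_I (hk a) _).1
  · rw [← S.tp_mul]; exact (S.mul_mem_I (hk b) _).2

/-- If `𝒜` is biflat and the left action is trivial, then `I` lies in the closed span of the
tensors `a ⊗ k` with `k ∈ rightKernel`. -/
theorem I_le_closure_span (S : ModuleSetting 𝔄 𝒜 T) {f : 𝔄 →L[ℂ] ℂ}
    (hf : S.TrivialLeftAction f) (hb : S.toTensorSquareSetting.Biflat) :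
    S.I ≤ (Submodule.span ℂ
      {t : T | ∃ a, ∃ k ∈ S.rightKernel, t = S.tp a k}).topologicalClosure := by
  have := S.isScalarTower
  have := S.smulCommClass
  set s : Set T := {t : T | ∃ a, ∃ k ∈ S.rightKernel, t = S.tp a k} with hs
  set P := (Submodule.span ℂ s).topologicalClosure with hP
  have hsP : ∀ a, ∀ k ∈ S.rightKernel, S.tp a k ∈ P := fun a k hk =>
    Submodule.le_topologicalClosure _ (Submodule.subset_span ⟨a, k, hk, rfl⟩)
  have hPc : IsClosed (P : Set T) := Submodule.isClosed_topologicalClosure _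
  have all : ∀ φ : T →L[ℂ] T, (∀ c d, φ (S.tp c d) ∈ P) → ∀ y, φ y ∈ P := fun φ h y => by
    have : P.comap φ.toLinearMap = ⊤ := S.eq_top_of_tp_mem (hPc.preimage φ.continuous) h
    have hy : y ∈ P.comap φ.toLinearMap := this ▸ Submodule.mem_top
    exact hy
  rw [S.hI]
  refine closedIdealGen_le ?_ hPc fun x hx y => ⟨?_, ?_⟩
  · rintro _ ⟨α, a, b, rfl⟩
    have h : S.tlsmul α (S.tp a b) - S.trsmul α (S.tp a b)
        = S.tp a (f α • b - S.rsmul α b) := by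
      rw [S.tlsmul_tp, S.trsmul_tp, hf, S.tp_smul_left, ← S.tp_smul_right]
      exact (map_sub (S.tpRight a) _ _).symm
    rw [h]
    exact hsP _ _ (S.mem_rightKernel.2 fun c => S.tp_sub_mem_I hf α c b)
  · refine ((ContinuousLinearMap.mul ℂ T).flip y).mem_of_mem_topologicalClosure_span hPc ?_ hx
    rintro _ ⟨a, k, hk, rfl⟩
    refine all (ContinuousLinearMap.mul ℂ T (S.tp a k)) (fun c d => ?_) y
    rw [ContinuousLinearMap.mul_apply', S.tp_mul]
    exact hsP _ _ (S.mul_mem_rightKernel hb hk d).1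
  · refine (ContinuousLinearMap.mul ℂ T y).mem_of_mem_topologicalClosure_span hPc ?_ hx
    rintro _ ⟨a, k, hk, rfl⟩
    refine all ((ContinuousLinearMap.mul ℂ T).flip (S.tp a k)) (fun c d => ?_) y
    rw [ContinuousLinearMap.flip_apply, ContinuousLinearMap.mul_apply', S.tp_mul]
    exact hsP _ _ (S.mul_mem_rightKernel hb hk d).2

/-- If `𝒜` is biflat and the left action is trivial, then `J` lies in the closed span of the
products `a k` with `k ∈ rightKernel`. -/
theorem J_le_closure_span (S : ModuleSetting 𝔄 𝒜 T) {f : 𝔄 →L[ℂ] ℂ}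
    (hf : S.TrivialLeftAction f) (hb : S.toTensorSquareSetting.Biflat) :
    S.J ≤ (Submodule.span ℂ
      {x : 𝒜 | ∃ a, ∃ k ∈ S.rightKernel, x = a * k}).topologicalClosure := by
  set M := (Submodule.span ℂ
    {x : 𝒜 | ∃ a, ∃ k ∈ S.rightKernel, x = a * k}).topologicalClosure with hM
  have hsM : ∀ a, ∀ k ∈ S.rightKernel, a * k ∈ M := fun a k hk =>
    Submodule.le_topologicalClosure _ (Submodule.subset_span ⟨a, k, hk, rfl⟩)
  have hMc : IsClosed (M : Set 𝒜) := Submodule.isClosed_topologicalClosure _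
  rw [S.hJ]
  refine closedIdealGen_le ?_ hMc fun x hx y => ⟨?_, ?_⟩
  · rintro _ ⟨t, ht, rfl⟩
    refine S.ω.mem_of_mem_topologicalClosure_span hMc ?_ (S.I_le_closure_span hf hb ht)
    rintro _ ⟨a, k, hk, rfl⟩
    rw [S.ω_tp]
    exact hsM a k hk
  · refine ((ContinuousLinearMap.mul ℂ 𝒜).flip y).mem_of_mem_topologicalClosure_span hMc ?_ hx
    rintro _ ⟨a, k, hk, rfl⟩
    rw [ContinuousLinearMap.flip_apply, ContinuousLinearMap.mul_apply', mul_assoc]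
    exact hsM _ _ (S.mul_mem_rightKernel hb hk y).1
  · refine (ContinuousLinearMap.mul ℂ 𝒜 y).mem_of_mem_topologicalClosure_span hMc ?_ hx
    rintro _ ⟨a, k, hk, rfl⟩
    rw [ContinuousLinearMap.mul_apply', ← mul_assoc]
    exact hsM _ _ hk

/-- A right module map `θ : T* → 𝒜*` sends functionals vanishing on `I` to functionals
vanishing on `J`, when `𝒜` is biflat and the left action is trivial. -/
theorem J_le_ker (S : ModuleSetting 𝔄 𝒜 T) {f : 𝔄 →L[ℂ] ℂ}
    (hf : S.TrivialLeftAction f) (hb : S.toTensorSquareSetting.Biflat)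
    {θ : (T →L[ℂ] ℂ) →L[ℂ] (𝒜 →L[ℂ] ℂ)}
    (hθ : ∀ (a : 𝒜) (F : T →L[ℂ] ℂ),
      θ (F.comp (S.rmul a)) = (θ F).comp ((ContinuousLinearMap.mul ℂ 𝒜).flip a))
    {F : T →L[ℂ] ℂ} (hF : S.I ≤ F.ker) : S.J ≤ (θ F).ker := by
  refine (S.J_le_closure_span hf hb).trans
    (Submodule.topologicalClosure_minimal _ (Submodule.span_le.2 ?_) (θ F).isClosed_ker)
  rintro _ ⟨x, k, hk, rfl⟩
  have h0 : F.comp (S.rmul k) = 0 := S.ext_tp fun b c => by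
    rw [ContinuousLinearMap.comp_apply, S.rmul_tp]
    exact hF (S.mem_rightKernel.1 (S.mul_mem_rightKernel hb hk c).2 b)
  have h := congrArg (fun l : 𝒜 →L[ℂ] ℂ => l x) (hθ k F)
  simp only [h0, map_zero] at h
  exact h.symm

end ModuleSetting

/-- Proposition 2.5.
Assume `𝔄` acts trivially on `𝒜` from the left and `𝒜 ⧸ J` has a left identity.
If the Banach algebra `𝒜` is biflat, then `𝒜` is module biflat (as an `𝔄`-module). -/
theorem stmt2 (S : ModuleSetting 𝔄 𝒜 T) (f : 𝔄 →L[ℂ] ℂ)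
    (hf : S.TrivialLeftAction f)
    (hid : S.HasLeftIdentity)
    (hbiflat : S.toTensorSquareSetting.Biflat) :
    S.ModuleBiflat := by
  have hb := hbiflat
  obtain ⟨θ, hr, hl, hω⟩ := hbiflat
  have hF : ∀ g : (T ⧸ S.I) →L[ℂ] ℂ, S.I ≤ (g.comp S.I.mkQL).ker := fun g t ht => by
    have h0 : S.I.mkQL t = 0 := (Submodule.Quotient.mk_eq_zero S.I).2 ht
    exact (congrArg g h0).trans (map_zero g)
  let Θ : ((T ⧸ S.I) →L[ℂ] ℂ) → ((𝒜 ⧸ S.J) →L[ℂ] ℂ) := fun g =>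
    S.J.liftQL (θ (g.comp S.I.mkQL)) (S.J_le_ker hf hb hr (hF g))
  have hΘ : ∀ g (a : 𝒜), Θ g (Submodule.Quotient.mk a) = θ (g.comp S.I.mkQL) a :=
    fun _ _ => rfl
  have ext : ∀ {g h : (𝒜 ⧸ S.J) →L[ℂ] ℂ},
      (∀ a : 𝒜, g (Submodule.Quotient.mk a) = h (Submodule.Quotient.mk a)) → g = h := by
    intro g h hgh
    ext x
    obtain ⟨a, rfl⟩ := Submodule.Quotient.mk_surjective S.J x
    exact hgh a
  have hsmul : ∀ (z : ℂ) g, Θ (z • g) = z • Θ g := fun z g => ext fun a => by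
    rw [hΘ, ContinuousLinearMap.smul_comp, map_smul]; rfl
  have hqtr : ∀ α, S.qtrsmul α = f α • ContinuousLinearMap.id ℂ (T ⧸ S.I) := fun α => by
    ext x
    obtain ⟨t, rfl⟩ := Submodule.Quotient.mk_surjective S.I x
    rw [S.qtrsmul_mk]
    exact ((Submodule.Quotient.eq S.I).2 (S.smul_sub_trsmul_mem_I hf α t)).symm
  have hqtl : ∀ α, S.qtlsmul α = f α • ContinuousLinearMap.id ℂ (T ⧸ S.I) := fun α => by
    ext x
    obtain ⟨t, rfl⟩ := Submodule.Quotient.mk_surjective S.I x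
    rw [S.qtlsmul_mk, S.tlsmul_eq_smul hf]
    rfl
  have hqr : ∀ α, S.qrsmul α = f α • ContinuousLinearMap.id ℂ (𝒜 ⧸ S.J) := fun α => by
    ext x
    obtain ⟨t, rfl⟩ := Submodule.Quotient.mk_surjective S.J x
    rw [S.qrsmul_mk]
    exact ((Submodule.Quotient.eq S.J).2 (S.smul_sub_rsmul_mem_J hf hb α t)).symm
  have hql : ∀ α, S.qlsmul α = f α • ContinuousLinearMap.id ℂ (𝒜 ⧸ S.J) := fun α => by
    ext x
    obtain ⟨t, rfl⟩ := Submodule.Quotient.mk_surjective S.J x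
    rw [S.qlsmul_mk, hf]
    rfl
  refine ⟨Θ, fun g h => ext fun a => ?_, ⟨‖θ‖, fun g => ?_⟩, fun α g => ?_, fun α g => ?_,
    fun a g => ext fun x => ?_, fun a g => ext fun x => ?_, fun g => ext fun a => ?_⟩
  · rw [hΘ, ContinuousLinearMap.add_comp, map_add]; rfl
  · have hmk : ‖g.comp S.I.mkQL‖ ≤ ‖g‖ :=
      ContinuousLinearMap.opNorm_le_bound _ (norm_nonneg g) fun t =>
        (g.le_opNorm _).trans (mul_le_mul_of_nonneg_left
          (Submodule.Quotient.norm_mk_le S.I t) (norm_nonneg g))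
    have hθg : ‖θ (g.comp S.I.mkQL)‖ ≤ ‖θ‖ * ‖g‖ :=
      (θ.le_opNorm _).trans (mul_le_mul_of_nonneg_left hmk (norm_nonneg θ))
    have hc : 0 ≤ ‖θ‖ * ‖g‖ := by positivity
    refine ContinuousLinearMap.opNorm_le_bound _ hc fun x => ?_
    refine le_of_forall_pos_le_add fun ε hε => ?_
    have hδ : 0 < ε / (‖θ‖ * ‖g‖ + 1) := by positivity
    obtain ⟨a, rfl, ha⟩ := Submodule.Quotient.norm_mk_lt x hδ
    rw [hΘ]
    refine ((θ (g.comp S.I.mkQL)).le_of_opNorm_le hθg a).trans ?_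
    refine (mul_le_mul_of_nonneg_left ha.le hc).trans ?_
    rw [mul_add]
    gcongr
    rw [mul_div_assoc', div_le_iff₀ (by positivity)]
    nlinarith
  · rw [hqtr, hqr, ContinuousLinearMap.comp_smul, ContinuousLinearMap.comp_smul,
      ContinuousLinearMap.comp_id, ContinuousLinearMap.comp_id, hsmul]
  · rw [hqtl, hql, ContinuousLinearMap.comp_smul, ContinuousLinearMap.comp_smul,
      ContinuousLinearMap.comp_id, ContinuousLinearMap.comp_id, hsmul]
  · have h : (g.comp (S.qrmul a)).comp S.I.mkQL = (g.comp S.I.mkQL).comp (S.rmul a) := by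
      ext t
      exact congrArg g (S.qrmul_mk a t)
    rw [hΘ, h, hr, ContinuousLinearMap.comp_apply, ContinuousLinearMap.comp_apply,
      S.qmulR_mk, hΘ]
    rfl
  · have h : (g.comp (S.qlmul a)).comp S.I.mkQL = (g.comp S.I.mkQL).comp (S.lmul a) := by
      ext t
      exact congrArg g (S.qlmul_mk a t)
    rw [hΘ, h, hl, ContinuousLinearMap.comp_apply, ContinuousLinearMap.comp_apply,
      S.qmulL_mk, hΘ]
    rfl
  · have h : (g.comp S.qω).comp S.I.mkQL = (g.comp S.J.mkQL).comp S.ω := by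
      ext t
      exact congrArg g (S.qω_mk t)
    rw [hΘ, h, hω]
    rfl
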